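/- arXiv:2506.07290 — 8 statements merged into one kernel-verified Lean document; each statement's English description precedes it below -/
import Mathlib

section
/- Let R > 0 and let (α_k) satisfy the recurrence α_{k+1} = α_k·(1 − (1/((k+1)(k+3)))·(α_k²R²/(1 − α_k²R²))). If α_0 ∈ (0, 3/(4R)), then the sequence (α_k) is monotonically decreasing (α_{k+1} ≤ α_k for all k, with α_k > 0 for all k) and converges to a strictly positive limit. -/
open Filter Topology

/-- For `a²R² < 9/16`, the factor `a²R² / (1 - a²R²)` lies in `[0, 9/7]`. -/
lemma sq_mul_sq_div_one_sub_mem_Icc {R a b : ℝ} (hR : 0 < R) (ha : 0 < a) (hab : a ≤ b)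
    (hb : b < 3 / (4 * R)) :
    0 ≤ a ^ 2 * R ^ 2 / (1 - a ^ 2 * R ^ 2) ∧
      a ^ 2 * R ^ 2 / (1 - a ^ 2 * R ^ 2) ≤ 9 / 7 := by
  have haR : a * R < 3 / 4 := by
    have h := (lt_div_iff₀ (by positivity)).1 (hab.trans_lt hb)
    linarith
  have hpos : 0 < a * R := by positivity
  have hsq : a ^ 2 * R ^ 2 < 9 / 16 := by nlinarith
  refine ⟨div_nonneg (by positivity) (by linarith), ?_⟩
  rw [div_le_iff₀ (by linarith)]
  linarith

/-- The decrements `9/7 · 1/((k+1)(k+3))` telescope, and their total `27/28` is less than `1`. -/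
lemma stepSize_bounds {R : ℝ} (hR : 0 < R) {α : ℕ → ℝ}
    (hrec : ∀ k : ℕ, α (k + 1) =
      α k * (1 - (1 / (((k : ℝ) + 1) * ((k : ℝ) + 3))) *
        ((α k) ^ 2 * R ^ 2 / (1 - (α k) ^ 2 * R ^ 2))))
    (h0 : 0 < α 0) (h1 : α 0 < 3 / (4 * R)) (k : ℕ) :
    α 0 * (1 / 28 + 9 / 14 * (1 / ((k : ℝ) + 1) + 1 / ((k : ℝ) + 2))) ≤ α k ∧
      α k ≤ α 0 ∧ α (k + 1) ≤ α k := by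
  have step (k : ℕ) (hpos : 0 < α k) (hle : α k ≤ α 0) :
      α (k + 1) ≤ α k ∧
        α k - α 0 * (9 / 7 * (1 / (((k : ℝ) + 1) * ((k : ℝ) + 3)))) ≤ α (k + 1) := by
    obtain ⟨hq0, hq1⟩ := sq_mul_sq_div_one_sub_mem_Icc hR hpos hle h1
    rw [hrec k]
    set q := α k ^ 2 * R ^ 2 / (1 - α k ^ 2 * R ^ 2)
    have hd : 0 ≤ 1 / (((k : ℝ) + 1) * ((k : ℝ) + 3)) := by positivity
    set d := 1 / (((k : ℝ) + 1) * ((k : ℝ) + 3))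
    have hnonneg : 0 ≤ α k * (d * q) := by positivity
    have hbound : α k * (d * q) ≤ α 0 * (d * (9 / 7)) := by gcongr
    constructor <;> linarith
  induction k with
  | zero =>
    refine ⟨?_, le_rfl, (step 0 h0 le_rfl).1⟩
    norm_num
  | succ k ih =>
    obtain ⟨hlow, hle, hdec⟩ := ih
    have hpos : 0 < α k := lt_of_lt_of_le (by positivity) hlow
    have hlow' : α 0 * (1 / 28 + 9 / 14 * (1 / (((k + 1 : ℕ) : ℝ) + 1) +
        1 / (((k + 1 : ℕ) : ℝ) + 2))) ≤ α (k + 1) := by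
      refine le_trans (le_of_eq ?_) ((sub_le_sub_right hlow _).trans (step k hpos hle).2)
      push_cast
      have h3 : (k : ℝ) + 1 + 2 = k + 3 := by ring
      have h2 : (k : ℝ) + 1 + 1 = k + 2 := by ring
      rw [h3, h2]
      field_simp
      ring
    have hpos' : 0 < α (k + 1) := lt_of_lt_of_le (by positivity) hlow'
    exact ⟨hlow', hdec.trans hle, (step (k + 1) hpos' (hdec.trans hle)).1⟩

/-- If `α₀ ∈ (0, 3/(4R))`, the EAG-V step-size sequence monotonically
decreases (staying positive) and converges to a strictly positive limit. -/
theorem stmt_0 (R : ℝ) (hR : 0 < R) (α : ℕ → ℝ)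
    (hrec : ∀ k : ℕ, α (k + 1) =
      α k * (1 - (1 / (((k : ℝ) + 1) * ((k : ℝ) + 3))) *
        ((α k) ^ 2 * R ^ 2 / (1 - (α k) ^ 2 * R ^ 2))))
    (h0 : 0 < α 0) (h1 : α 0 < 3 / (4 * R)) :
    (∀ k : ℕ, α (k + 1) ≤ α k ∧ 0 < α k) ∧
      ∃ L : ℝ, 0 < L ∧ Tendsto α atTop (𝓝 L) := by
  have hbounds := stepSize_bounds hR hrec h0 h1
  have hlow (k : ℕ) : α 0 * (1 / 28) ≤ α k := by
    refine le_trans ?_ (hbounds k).1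
    gcongr
    exact le_add_of_nonneg_right (by positivity)
  refine ⟨fun k => ⟨(hbounds k).2.2, lt_of_lt_of_le (by positivity) (hlow k)⟩, ?_⟩
  have hlim := tendsto_atTop_ciInf (antitone_nat_of_succ_le fun k => (hbounds k).2.2)
    ⟨α 0 * (1 / 28), Set.forall_mem_range.2 hlow⟩
  exact ⟨_, lt_of_lt_of_le (by positivity) (le_ciInf hlow), hlim⟩
end

section
/- Let R > 0 and K ≥ 1, and let (α_k) satisfy the recurrence α_{k+1} = α_k·(1 − (1/((k+1)(k+3)))·(α_k²R²/(1 − α_k²R²))). If α_0 ∈ (0, η) where η := min{3/(4R√K), 1/(√2·R)}, then the sequence (α_k) is monotonically decreasing (α_{k+1} ≤ α_k for all k, with α_k > 0 for all k) and converges to a strictly positive limit. -/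
open Filter Topology

/-- If `0 ≤ a`, `a ^ 2 * R ^ 2 < 1 / 2` and `0 ≤ c`, one step decreases `a` by at most `c * a`. -/
lemma step_bounds {a R c : ℝ} (ha : 0 ≤ a) (hx : a ^ 2 * R ^ 2 < 1 / 2) (hc : 0 ≤ c) :
    a * (1 - c * (a ^ 2 * R ^ 2 / (1 - a ^ 2 * R ^ 2))) ≤ a ∧
      a - c * a ≤ a * (1 - c * (a ^ 2 * R ^ 2 / (1 - a ^ 2 * R ^ 2))) := by
  have hq0 : 0 ≤ a ^ 2 * R ^ 2 / (1 - a ^ 2 * R ^ 2) :=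
    div_nonneg (by positivity) (by linarith)
  have hq1 : a ^ 2 * R ^ 2 / (1 - a ^ 2 * R ^ 2) ≤ 1 := by
    rw [div_le_one (by linarith)]
    linarith
  have hac : 0 ≤ a * c := mul_nonneg ha hc
  constructor
  · nlinarith [mul_nonneg hac hq0]
  · nlinarith [mul_le_mul_of_nonneg_left hq1 hac]

/-- With `K ≥ 1` and `α₀ ∈ (0, min (3/(4R√K)) (1/(√2 R)))`, the EAG-V
step-size sequence monotonically decreases (staying positive) and converges to a
strictly positive limit. -/
theorem stmt_1 (R K : ℝ) (hR : 0 < R) (hK : 1 ≤ K) (α : ℕ → ℝ)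
    (hrec : ∀ k : ℕ, α (k + 1) =
      α k * (1 - (1 / (((k : ℝ) + 1) * ((k : ℝ) + 3))) *
        ((α k) ^ 2 * R ^ 2 / (1 - (α k) ^ 2 * R ^ 2))))
    (h0 : 0 < α 0)
    (h1 : α 0 < min (3 / (4 * R * Real.sqrt K)) (1 / (Real.sqrt 2 * R))) :
    (∀ k : ℕ, α (k + 1) ≤ α k ∧ 0 < α k) ∧
      ∃ L : ℝ, 0 < L ∧ Tendsto α atTop (𝓝 L) := by
  have hx0 : (α 0) ^ 2 * R ^ 2 < 1 / 2 := by
    have h := h1.trans_le (min_le_right _ _)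
    rw [lt_div_iff₀ (by positivity)] at h
    have hsq : (α 0 * (√2 * R)) ^ 2 < 1 :=
      pow_lt_one₀ (by positivity) h two_ne_zero
    have h2 : √2 ^ 2 = (2 : ℝ) := Real.sq_sqrt zero_le_two
    rw [mul_pow, mul_pow, h2] at hsq
    linarith
  have hsmall : ∀ a : ℝ, 0 ≤ a → a ≤ α 0 → a ^ 2 * R ^ 2 < 1 / 2 := fun a ha h =>
    (mul_le_mul_of_nonneg_right (pow_le_pow_left₀ ha h 2) (sq_nonneg R)).trans_lt hx0
  have hstep : ∀ k : ℕ, 0 ≤ α k → α k ≤ α 0 → α (k + 1) ≤ α k ∧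
      α k - 1 / (((k : ℝ) + 1) * ((k : ℝ) + 3)) * α k ≤ α (k + 1) := by
    intro k hk hk0
    rw [hrec k]
    exact step_bounds hk (hsmall _ hk hk0) (by positivity)
  -- The weights `1 / ((k + 1) * (k + 3))` telescope, with total sum `3 / 4`.
  have hinv : ∀ k : ℕ, α 0 * (1 / 4 + (1 / ((k : ℝ) + 1) + 1 / ((k : ℝ) + 2)) / 2) ≤ α k ∧
      α k ≤ α 0 := by
    intro k
    induction k with
    | zero => norm_num
    | succ k ih =>
      obtain ⟨hlow, hup⟩ := ih
      have hpos : 0 ≤ α k := le_trans (by positivity) hlow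
      obtain ⟨hdec, hge⟩ := hstep k hpos hup
      refine ⟨?_, hdec.trans hup⟩
      have hc : 1 / (((k : ℝ) + 1) * ((k : ℝ) + 3)) * α k ≤
          1 / (((k : ℝ) + 1) * ((k : ℝ) + 3)) * α 0 :=
        mul_le_mul_of_nonneg_left hup (by positivity)
      have htel : α 0 * (1 / 4 + (1 / (((k + 1 : ℕ) : ℝ) + 1) + 1 / (((k + 1 : ℕ) : ℝ) + 2)) / 2) =
          α 0 * (1 / 4 + (1 / ((k : ℝ) + 1) + 1 / ((k : ℝ) + 2)) / 2) -
            1 / (((k : ℝ) + 1) * ((k : ℝ) + 3)) * α 0 := by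
        have e1 : (k : ℝ) + 1 + 1 = k + 2 := by ring
        have e2 : (k : ℝ) + 1 + 2 = k + 3 := by ring
        push_cast
        rw [e1, e2]
        field_simp
        ring
      linarith
  have hlower : ∀ k : ℕ, α 0 / 4 ≤ α k := by
    intro k
    have h : 0 ≤ α 0 * ((1 / ((k : ℝ) + 1) + 1 / ((k : ℝ) + 2)) / 2) := by positivity
    linarith [(hinv k).1]
  have hpos : ∀ k : ℕ, 0 < α k := fun k => lt_of_lt_of_le (by positivity) (hlower k)
  have hdec : ∀ k : ℕ, α (k + 1) ≤ α k := fun k => (hstep k (hpos k).le (hinv k).2).1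
  refine ⟨fun k => ⟨hdec k, hpos k⟩, ⨅ k, α k, ?_, ?_⟩
  · exact lt_of_lt_of_le (by positivity) (le_ciInf hlower)
  · exact tendsto_atTop_ciInf (antitone_nat_of_succ_le hdec)
      ⟨α 0 / 4, Set.forall_mem_range.2 hlower⟩
end

section
/- Let (α_k) satisfy the recurrence α_{k+1} = α_k·(1 − (1/((k+1)(k+3)))·(α_k²/(1 − α_k²))) (i.e., the recurrence with R = 1). Fix N ≥ 0 and ρ ∈ (0, 3/4), and suppose 0 < α_N < ρ. Set η := (1/2)·(1/(N+1) + 1/(N+2))·(ρ²/(1 − ρ²)). Then η < 1, and for every k ≥ 0 one has (1 − η)·α_N < α_{N+k} ≤ α_N and α_{N+k+1} ≤ α_{N+k}; consequently α_{N+k} < ρ for all k ≥ 0. -/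
/-- The function `x ↦ x² / (1 - x²)` is nonnegative and monotone on `[0, 1)`. -/
theorem sq_div_one_sub_sq_mem_Icc {x y : ℝ} (hx : 0 ≤ x) (hxy : x ≤ y) (hy : y < 1) :
    0 ≤ x ^ 2 / (1 - x ^ 2) ∧ x ^ 2 / (1 - x ^ 2) ≤ y ^ 2 / (1 - y ^ 2) := by
  have h1 : x ^ 2 ≤ y ^ 2 := by gcongr
  have h2 : 0 < 1 - y ^ 2 := by nlinarith
  have h3 : 0 < 1 - x ^ 2 := by linarith
  exact ⟨by positivity, by gcongr⟩

/-- The telescoping identity for the weights `1 / ((x + 1) * (x + 3))`. -/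
theorem one_div_mul_eq_telescope {x : ℝ} (hx : 0 ≤ x) :
    1 / ((x + 1) * (x + 3)) =
      1 / 2 * (1 / (x + 1) + 1 / (x + 2)) - 1 / 2 * (1 / (x + 1 + 1) + 1 / (x + 1 + 2)) := by
  have h1 : x + 1 ≠ 0 := by positivity
  have h2 : x + 2 ≠ 0 := by positivity
  have h3 : x + 3 ≠ 0 := by positivity
  rw [show x + 1 + 1 = x + 2 by ring, show x + 1 + 2 = x + 3 by ring]
  field_simp
  ring


/-- With `R = 1`, `0 < α_N < ρ < 3/4`, and
`η := (1/2)(1/(N+1) + 1/(N+2)) ρ²/(1−ρ²)`, one has `η < 1`, and for all `k ≥ 0`,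
`(1−η) α_N < α_{N+k} ≤ α_N`, `α_{N+k+1} ≤ α_{N+k}`, and `α_{N+k} < ρ`. -/
theorem stmt_2 (α : ℕ → ℝ)
    (hrec : ∀ k : ℕ, α (k + 1) =
      α k * (1 - (1 / (((k : ℝ) + 1) * ((k : ℝ) + 3))) *
        ((α k) ^ 2 / (1 - (α k) ^ 2))))
    (N : ℕ) (ρ : ℝ) (hρ0 : 0 < ρ) (hρ1 : ρ < 3 / 4)
    (hN0 : 0 < α N) (hNρ : α N < ρ) :
    (1 / 2) * (1 / ((N : ℝ) + 1) + 1 / ((N : ℝ) + 2)) * (ρ ^ 2 / (1 - ρ ^ 2)) < 1 ∧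
    ∀ k : ℕ,
      (1 - (1 / 2) * (1 / ((N : ℝ) + 1) + 1 / ((N : ℝ) + 2)) * (ρ ^ 2 / (1 - ρ ^ 2)))
          * α N < α (N + k) ∧
      α (N + k) ≤ α N ∧
      α (N + k + 1) ≤ α (N + k) ∧
      α (N + k) < ρ := by
  set T : ℝ → ℝ := fun x => 1 / 2 * (1 / (x + 1) + 1 / (x + 2)) with hT
  set c : ℝ := ρ ^ 2 / (1 - ρ ^ 2) with hc
  change T N * c < 1 ∧ ∀ k : ℕ, (1 - T N * c) * α N < α (N + k) ∧ _
  have hcpos : 0 < c := div_pos (by positivity) (by nlinarith)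
  have hη : T N * c < 1 := by
    have hc1 : c < 9 / 7 := by
      rw [hc, div_lt_div_iff₀ (by nlinarith) (by norm_num)]
      nlinarith
    have hTN : T N ≤ 3 / 4 := by
      have h1 : 1 / ((N : ℝ) + 1) ≤ 1 / 1 := by gcongr; simp
      have h2 : 1 / ((N : ℝ) + 2) ≤ 1 / 2 := by gcongr; simp
      simp only [hT]
      linarith
    nlinarith
  have hTpos : ∀ m : ℕ, 0 < T m := fun m => by simp only [hT]; positivity
  have lower_strict : ∀ m : ℕ, (1 - (T N - T m) * c) * α N ≤ α m →
      (1 - T N * c) * α N < α m := fun m h => by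
    nlinarith [mul_pos (mul_pos (hTpos m) hcpos) hN0]
  have step : ∀ m : ℕ, (1 - (T N - T m) * c) * α N ≤ α m → α m ≤ α N →
      (1 - (T N - T (m + 1 : ℕ)) * c) * α N ≤ α (m + 1) ∧ α (m + 1) ≤ α m := by
    intro m hlow hup
    have hpos : 0 < α m :=
      (mul_pos (sub_pos.2 hη) hN0).trans (lower_strict m hlow)
    obtain ⟨ht0, htc⟩ := sq_div_one_sub_sq_mem_Icc hpos.le (hup.trans hNρ.le) (by linarith)
    have htel : 1 / (((m : ℝ) + 1) * ((m : ℝ) + 3)) = T m - T (m + 1 : ℕ) := by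
      simp only [hT, Nat.cast_add, Nat.cast_one]
      exact one_div_mul_eq_telescope m.cast_nonneg
    have hw : 0 ≤ T m - T (m + 1 : ℕ) := by rw [← htel]; positivity
    rw [hrec m, htel]
    have hbound : α m * ((T m - T (m + 1 : ℕ)) * (α m ^ 2 / (1 - α m ^ 2))) ≤
        α N * ((T m - T (m + 1 : ℕ)) * c) := by gcongr
    have hnonneg : 0 ≤ α m * ((T m - T (m + 1 : ℕ)) * (α m ^ 2 / (1 - α m ^ 2))) :=
      mul_nonneg hpos.le (mul_nonneg hw ht0)
    constructor <;> linarith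
  have invariant : ∀ k : ℕ, (1 - (T N - T (N + k : ℕ)) * c) * α N ≤ α (N + k) ∧
      α (N + k) ≤ α N := by
    intro k
    induction k with
    | zero => simp
    | succ k ih =>
      obtain ⟨h1, h2⟩ := step (N + k) ih.1 ih.2
      exact ⟨h1, h2.trans ih.2⟩
  refine ⟨hη, fun k => ?_⟩
  obtain ⟨hlow, hup⟩ := invariant k
  exact ⟨lower_strict _ hlow, hup, (step _ hlow hup).2, hup.trans_lt hNρ⟩
end

section
/- Let E be a real inner product space, let R > 0, and let G : E → E be a monotone operator (⟨G(u) − G(v), u − v⟩ ≥ 0 for all u, v ∈ E) that is R-Lipschitz. Let z* ∈ E be fixed. Let (β_k) ⊂ (0,1), let α_0 ∈ (0, 1/R), and define B_0 = 1, B_{k+1} = B_k/(1 − β_k), A_k = (α_k/(2β_k))·B_k, and α_{k+1} = α_k·β_{k+1}·(1 − α_k²R² − β_k²)/(β_k·(1 − β_k)·(1 − α_k²R²)); assume α_k ∈ (0, 1/R) for all k. Let c_0 > 0 and (δ_k) be positive reals, and set c_{k+1} = c_k/(1 + δ_k) and γ_{k+1} = B_{k+1}/(c_{k+1}·(1 +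 1/δ_k)). Define iterates by z̄^0 = z^0, z^{k+1/2} = z^k + β_k(z̄^k − z^k) − α_k G(z^k), z^{k+1} = z^k + β_k(z̄^k − z^k) − α_k G(z^{k+1/2}), z̄^{k+1} = z̄^k + γ_{k+1} G(z^{k+1}). Then the Lyapunov functional V_k := A_k‖G(z^k)‖² + B_k⟨G(z^k), z^k − z̄^k⟩ + c_k‖z* − z̄^k‖² satisfies V_{k+1} ≤ V_k for all k ≥ 0. -/
open RealInnerProductSpace

/-- The weighted Young inequality `‖x - γ g‖² ≤ (1 + δ) ‖x‖² + (1 + 1/δ) γ² ‖g‖²`. -/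
lemma norm_sub_smul_sq_le {E : Type*} [NormedAddCommGroup E] [InnerProductSpace ℝ E]
    (x g : E) (γ : ℝ) {δ : ℝ} (hδ : 0 < δ) :
    ‖x - γ • g‖ ^ 2 ≤ (1 + δ) * ‖x‖ ^ 2 + (1 + 1 / δ) * γ ^ 2 * ‖g‖ ^ 2 := by
  have h : 0 ≤ 1 / δ * ‖δ • x + γ • g‖ ^ 2 := by positivity
  have e₁ : ‖δ • x + γ • g‖ ^ 2 = δ ^ 2 * ‖x‖ ^ 2 + 2 * (δ * (γ * ⟪x, g⟫)) + γ ^ 2 * ‖g‖ ^ 2 := by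
    rw [norm_add_sq_real, real_inner_smul_left, real_inner_smul_right, norm_smul, norm_smul,
      mul_pow, mul_pow, Real.norm_eq_abs, Real.norm_eq_abs, sq_abs, sq_abs]
  have e₂ : ‖x - γ • g‖ ^ 2 = ‖x‖ ^ 2 - 2 * (γ * ⟪x, g⟫) + γ ^ 2 * ‖g‖ ^ 2 := by
    rw [norm_sub_sq_real, real_inner_smul_right, norm_smul, mul_pow, Real.norm_eq_abs, sq_abs]
  have e₃ : 1 / δ * ‖δ • x + γ • g‖ ^ 2 =
      (1 + δ) * ‖x‖ ^ 2 + (1 + 1 / δ) * γ ^ 2 * ‖g‖ ^ 2 - ‖x - γ • g‖ ^ 2 := by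
    rw [e₁, e₂]
    field_simp
    ring
  linarith

/-- One extragradient step with a fixed anchor: `g₀`, `gₕ`, `g₁` are the operator values at the
current, half and next iterates, `d` is the displacement from the current iterate to the anchor. -/
lemma anchored_extragradient_descent {E : Type*} [NormedAddCommGroup E] [InnerProductSpace ℝ E]
    (g₀ gₕ g₁ d : E) {α β b s : ℝ} (hα : 0 < α) (hβ : 0 < β) (hβ' : β < 1) (hb : 0 < b)
    (hs : 0 < s) (hs' : s < 1)
    (hmono : 0 ≤ ⟪g₁ - g₀, β • d - α • gₕ⟫)
    (hlip : ‖g₁ - gₕ‖ ^ 2 ≤ s * ‖g₀ - gₕ‖ ^ 2) :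
    α * (1 - s - β ^ 2) / (2 * β * (1 - β) * (1 - s)) * (b / (1 - β)) * ‖g₁‖ ^ 2 -
        b / (1 - β) * ⟪g₁, (1 - β) • d + α • gₕ⟫ ≤
      α / (2 * β) * b * ‖g₀‖ ^ 2 - b * ⟪g₀, d⟫ := by
  have h1β : 0 < 1 - β := sub_pos.2 hβ'
  have h1s : 0 < 1 - s := sub_pos.2 hs'
  have h₁ : 0 ≤ b / β * ⟪g₁ - g₀, β • d - α • gₕ⟫ := by positivity
  have h₂ : 0 ≤ b * α / (2 * β) / s * (s * ‖g₀ - gₕ‖ ^ 2 - ‖g₁ - gₕ‖ ^ 2) :=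
    mul_nonneg (by positivity) (sub_nonneg.2 hlip)
  have h₃ : 0 ≤ b * α / (2 * β) / (s * (1 - s)) *
      ‖(1 - s) • gₕ - (1 - s / (1 - β)) • g₁‖ ^ 2 := by positivity
  have key : α / (2 * β) * b * ‖g₀‖ ^ 2 - b * ⟪g₀, d⟫ -
      (α * (1 - s - β ^ 2) / (2 * β * (1 - β) * (1 - s)) * (b / (1 - β)) * ‖g₁‖ ^ 2 -
        b / (1 - β) * ⟪g₁, (1 - β) • d + α • gₕ⟫) =
      b / β * ⟪g₁ - g₀, β • d - α • gₕ⟫ +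
      b * α / (2 * β) / s * (s * ‖g₀ - gₕ‖ ^ 2 - ‖g₁ - gₕ‖ ^ 2) +
      b * α / (2 * β) / (s * (1 - s)) *
        ‖(1 - s) • gₕ - (1 - s / (1 - β)) • g₁‖ ^ 2 := by
    simp only [norm_sub_sq_real, inner_sub_left, inner_sub_right, inner_add_right,
      real_inner_smul_left, real_inner_smul_right, norm_smul, mul_pow, Real.norm_eq_abs, sq_abs,
      real_inner_comm g₁ gₕ]
    field_simp
    ring
  linarith

/-- the Lyapunov functional of the (deterministic) EAG-V algorithm with
moving anchor is nonincreasing. -/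
theorem stmt_5 {E : Type*} [NormedAddCommGroup E] [InnerProductSpace ℝ E]
    (R : ℝ) (hR : 0 < R) (G : E → E)
    (hmono : ∀ u v : E, 0 ≤ ⟪G u - G v, u - v⟫)
    (hlip : ∀ u v : E, ‖G u - G v‖ ≤ R * ‖u - v‖)
    (zstar : E)
    (β α A B c δ γ : ℕ → ℝ)
    (hβ : ∀ k, 0 < β k ∧ β k < 1)
    (hα0 : 0 < α 0 ∧ α 0 < 1 / R)
    (hB0 : B 0 = 1)
    (hB : ∀ k, B (k + 1) = B k / (1 - β k))
    (hA : ∀ k, A k = (α k / (2 * β k)) * B k)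
    (hαrec : ∀ k, α (k + 1) =
      α k * β (k + 1) * (1 - (α k) ^ 2 * R ^ 2 - (β k) ^ 2) /
        (β k * (1 - β k) * (1 - (α k) ^ 2 * R ^ 2)))
    (hαk : ∀ k, 0 < α k ∧ α k < 1 / R)
    (hc0 : 0 < c 0) (hδ : ∀ k, 0 < δ k)
    (hc : ∀ k, c (k + 1) = c k / (1 + δ k))
    (hγ : ∀ k, γ (k + 1) = B (k + 1) / (c (k + 1) * (1 + 1 / δ k)))
    (z zbar zhalf : ℕ → E)
    (hz0 : zbar 0 = z 0)
    (hhalf : ∀ k, zhalf k = z k + β k • (zbar k - z k) - α k • G (z k))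
    (hz : ∀ k, z (k + 1) = z k + β k • (zbar k - z k) - α k • G (zhalf k))
    (hzbar : ∀ k, zbar (k + 1) = zbar k + γ (k + 1) • G (z (k + 1))) :
    ∀ k : ℕ,
      A (k + 1) * ‖G (z (k + 1))‖ ^ 2 +
          B (k + 1) * ⟪G (z (k + 1)), z (k + 1) - zbar (k + 1)⟫ +
          c (k + 1) * ‖zstar - zbar (k + 1)‖ ^ 2
        ≤ A k * ‖G (z k)‖ ^ 2 + B k * ⟪G (z k), z k - zbar k⟫ +
            c k * ‖zstar - zbar k‖ ^ 2 := by
  intro k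
  have hBpos : ∀ n, 0 < B n := by
    intro n
    induction n with
    | zero => simp [hB0]
    | succ n ih => rw [hB]; exact div_pos ih (sub_pos.2 (hβ n).2)
  have hcpos : ∀ n, 0 < c n := by
    intro n
    induction n with
    | zero => exact hc0
    | succ n ih => rw [hc]; exact div_pos ih (by linarith [hδ n])
  obtain ⟨hβk, hβk'⟩ := hβ k
  obtain ⟨hα, hα'⟩ := hαk k
  have hαR : α k * R < 1 := (lt_div_iff₀ hR).1 hα'
  have hs : 0 < α k ^ 2 * R ^ 2 := by positivity
  have hs' : α k ^ 2 * R ^ 2 < 1 := by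
    rw [← mul_pow]
    exact pow_lt_one₀ (by positivity) hαR two_ne_zero
  have hmono' : 0 ≤ ⟪G (z (k + 1)) - G (z k), β k • (zbar k - z k) - α k • G (zhalf k)⟫ := by
    have hstep : z (k + 1) - z k = β k • (zbar k - z k) - α k • G (zhalf k) := by
      rw [hz k]; abel
    exact hstep ▸ hmono (z (k + 1)) (z k)
  have hlip' : ‖G (z (k + 1)) - G (zhalf k)‖ ^ 2 ≤
      α k ^ 2 * R ^ 2 * ‖G (z k) - G (zhalf k)‖ ^ 2 := by
    have hstep : z (k + 1) - zhalf k = α k • (G (z k) - G (zhalf k)) := by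
      rw [hz k, smul_sub (α k), hhalf k]; abel
    have h := hlip (z (k + 1)) (zhalf k)
    rw [hstep, norm_smul, Real.norm_of_nonneg hα.le] at h
    calc _ ≤ (R * (α k * ‖G (z k) - G (zhalf k)‖)) ^ 2 := by gcongr
      _ = _ := by ring
  have hdescent := anchored_extragradient_descent (G (z k)) (G (zhalf k)) (G (z (k + 1)))
    (zbar k - z k) hα hβk hβk' (hBpos k) hs hs' hmono' hlip'
  have hA1 : A (k + 1) = α k * (1 - α k ^ 2 * R ^ 2 - β k ^ 2) /
      (2 * β k * (1 - β k) * (1 - α k ^ 2 * R ^ 2)) * B (k + 1) := by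
    have h₁ := (hβ (k + 1)).1.ne'
    have h₂ := (sub_pos.2 hβk').ne'
    have h₃ := (sub_pos.2 hs').ne'
    rw [hA, hαrec]
    field_simp
  rw [← hB, ← hA1, ← hA] at hdescent
  have hanchor := mul_le_mul_of_nonneg_left (norm_sub_smul_sq_le (zstar - zbar k)
    (G (z (k + 1))) (γ (k + 1)) (hδ k)) (hcpos (k + 1)).le
  have hck : c (k + 1) * (1 + δ k) = c k := by
    rw [hc]
    exact div_mul_cancel₀ _ (by linarith [hδ k])
  have hγk : γ (k + 1) * (c (k + 1) * (1 + 1 / δ k)) = B (k + 1) := by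
    rw [hγ]
    have h₁ := hcpos (k + 1)
    have h₂ := hδ k
    exact div_mul_cancel₀ _ (by positivity)
  have hbar : zstar - zbar (k + 1) = zstar - zbar k - γ (k + 1) • G (z (k + 1)) := by
    rw [hzbar]; abel
  have hdisp : z (k + 1) - zbar (k + 1) =
      -((1 - β k) • (zbar k - z k) + α k • G (zhalf k)) - γ (k + 1) • G (z (k + 1)) := by
    rw [hzbar, hz k, sub_smul, one_smul]; abel
  have hneg : z k - zbar k = -(zbar k - z k) := (neg_sub _ _).symm
  rw [hbar, hdisp, hneg, inner_sub_right, inner_neg_right, inner_neg_right,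
    real_inner_smul_right (G (z (k + 1))) (G (z (k + 1))), real_inner_self_eq_norm_sq]
  have hsplit : c (k + 1) * ((1 + δ k) * ‖zstar - zbar k‖ ^ 2 +
      (1 + 1 / δ k) * γ (k + 1) ^ 2 * ‖G (z (k + 1))‖ ^ 2) =
      c k * ‖zstar - zbar k‖ ^ 2 + B (k + 1) * (γ (k + 1) * ‖G (z (k + 1))‖ ^ 2) := by
    rw [← hck, ← hγk]; ring
  rw [hsplit] at hanchor
  linarith
end

section
/- Let E be a real inner product space, R > 0, and G : E → E a monotone, R-Lipschitz operator with G(z*) = 0 for some z* ∈ E. Consider the EAG-V algorithm with moving anchor with β_k = 1/(k+2), so B_k = k+1 and A_k = α_k(k+1)(k+2)/2, where (α_k) follows the recurrence α_{k+1} = α_k·(1 − (1/((k+1)(k+3)))·(α_k²R²/(1 − α_k²R²))) with α_0 ∈ (0, 3/(4R)), and c_{k+1} = c_k/(1 + δ_k), γ_{k+1} = B_{k+1}/(c_{k+1}(1 + 1/δ_k)) with c_0 > 0, δ_k > 0. Suppose the Lyapunov functional V_k := A_k‖G(z^k)‖² + B_k⟨G(z^k), z^k − z̄^k⟩ + c_k‖z*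 − z̄^k‖² is nonincreasing, (α_k) decreases to a limit α_∞ > 0, (c_k) decreases to a limit c_∞, and c_∞·α_∞ ≥ 1. Then for all k ≥ 0: ‖G(z^k)‖² ≤ 4(α_0 R² + c_0)‖z^0 − z*‖² / (α_∞ (k+1)(k+2)). -/
open Filter Topology RealInnerProductSpace

/-- Completing the square: this quadratic expression in two vectors is nonnegative when `1 ≤ c * a`. -/
lemma quadratic_inner_nonneg {E : Type*} [NormedAddCommGroup E] [InnerProductSpace ℝ E]
    {a c : ℝ} (ha : 0 < a) (hac : 1 ≤ c * a) (n : ℝ) (g w : E) :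
    0 ≤ a * n ^ 2 / 4 * ‖g‖ ^ 2 + n * ⟪g, w⟫ + c * ‖w‖ ^ 2 := by
  have hsq : 0 ≤ ‖(a * n / 2) • g + w‖ ^ 2 := sq_nonneg _
  rw [norm_add_sq_real, real_inner_smul_left, norm_smul, mul_pow, Real.norm_eq_abs, sq_abs] at hsq
  have hw : 0 ≤ (c * a - 1) * ‖w‖ ^ 2 := mul_nonneg (by linarith) (sq_nonneg _)
  refine nonneg_of_mul_nonneg_right ?_ ha
  nlinarith

/-- convergence rate of the (deterministic) EAG-V algorithm with moving
anchor: `‖G(z^k)‖² ≤ 4(α₀R² + c₀)‖z⁰ − z*‖²/(α_∞ (k+1)(k+2))`. -/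
theorem stmt_6 {E : Type*} [NormedAddCommGroup E] [InnerProductSpace ℝ E]
    (R : ℝ) (hR : 0 < R) (G : E → E)
    (hmono : ∀ u v : E, 0 ≤ ⟪G u - G v, u - v⟫)
    (hlip : ∀ u v : E, ‖G u - G v‖ ≤ R * ‖u - v‖)
    (zstar : E) (hzstar : G zstar = 0)
    (α c δ γ : ℕ → ℝ) (z zbar zhalf : ℕ → E)
    (hα0 : 0 < α 0) (hα0' : α 0 < 3 / (4 * R))
    (hαrec : ∀ k : ℕ, α (k + 1) =
      α k * (1 - (1 / (((k : ℝ) + 1) * ((k : ℝ) + 3))) *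
        ((α k) ^ 2 * R ^ 2 / (1 - (α k) ^ 2 * R ^ 2))))
    (hc0 : 0 < c 0) (hδ : ∀ k, 0 < δ k)
    (hc : ∀ k, c (k + 1) = c k / (1 + δ k))
    (hγ : ∀ k : ℕ, γ (k + 1) = ((k : ℝ) + 2) / (c (k + 1) * (1 + 1 / δ k)))
    (hz0 : zbar 0 = z 0)
    (hhalf : ∀ k : ℕ, zhalf k =
      z k + (1 / ((k : ℝ) + 2)) • (zbar k - z k) - α k • G (z k))
    (hz : ∀ k : ℕ, z (k + 1) =
      z k + (1 / ((k : ℝ) + 2)) • (zbar k - z k) - α k • G (zhalf k))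
    (hzbar : ∀ k : ℕ, zbar (k + 1) = zbar k + γ (k + 1) • G (z (k + 1)))
    (hVdec : ∀ k : ℕ,
      (α (k + 1) * ((k : ℝ) + 2) * ((k : ℝ) + 3) / 2) * ‖G (z (k + 1))‖ ^ 2 +
          ((k : ℝ) + 2) * ⟪G (z (k + 1)), z (k + 1) - zbar (k + 1)⟫ +
          c (k + 1) * ‖zstar - zbar (k + 1)‖ ^ 2
        ≤ (α k * ((k : ℝ) + 1) * ((k : ℝ) + 2) / 2) * ‖G (z k)‖ ^ 2 +
            ((k : ℝ) + 1) * ⟪G (z k), z k - zbar k⟫ +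
            c k * ‖zstar - zbar k‖ ^ 2)
    (αinf cinf : ℝ)
    (hαdec : ∀ k, α (k + 1) ≤ α k) (hαlim : Tendsto α atTop (𝓝 αinf))
    (hαinf : 0 < αinf)
    (hcdec : ∀ k, c (k + 1) ≤ c k) (hclim : Tendsto c atTop (𝓝 cinf))
    (hca : 1 ≤ cinf * αinf) :
    ∀ k : ℕ, ‖G (z k)‖ ^ 2 ≤
      4 * (α 0 * R ^ 2 + c 0) * ‖z 0 - zstar‖ ^ 2 /
        (αinf * ((k : ℝ) + 1) * ((k : ℝ) + 2)) := by
  intro k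
  have hmonoV := antitone_nat_of_succ_le
    (f := fun k : ℕ => (α k * ((k : ℝ) + 1) * ((k : ℝ) + 2) / 2) * ‖G (z k)‖ ^ 2 +
      ((k : ℝ) + 1) * ⟪G (z k), z k - zbar k⟫ + c k * ‖zstar - zbar k‖ ^ 2)
    (fun m => by
      have h := hVdec m
      have h1 : (m : ℝ) + 1 + 1 = m + 2 := by ring
      have h2 : (m : ℝ) + 1 + 2 = m + 3 := by ring
      simpa only [Nat.cast_add, Nat.cast_one, h1, h2] using h)
  have hV := hmonoV (Nat.zero_le k)
  simp only [Nat.cast_zero, hz0, sub_self, inner_zero_right] at hV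
  have hG0 : ‖G (z 0)‖ ^ 2 ≤ R ^ 2 * ‖z 0 - zstar‖ ^ 2 := by
    have h := hlip (z 0) zstar
    rw [hzstar, sub_zero] at h
    rw [← mul_pow]
    exact pow_le_pow_left₀ (norm_nonneg _) h 2
  have hG0' := mul_le_mul_of_nonneg_left hG0 hα0.le
  rw [norm_sub_rev zstar (z 0)] at hV
  have hαk : αinf ≤ α k := (antitone_nat_of_succ_le hαdec).le_of_tendsto hαlim k
  have hck : cinf ≤ c k := (antitone_nat_of_succ_le hcdec).le_of_tendsto hclim k
  have hmk : 0 ≤ ⟪G (z k), z k - zstar⟫ := by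
    have h := hmono (z k) zstar
    rwa [hzstar, sub_zero] at h
  have hsplit : ⟪G (z k), z k - zbar k⟫ =
      ⟪G (z k), z k - zstar⟫ + ⟪G (z k), zstar - zbar k⟫ := by
    rw [← inner_add_right, sub_add_sub_cancel]
  have hq := quadratic_inner_nonneg hαinf hca ((k : ℝ) + 1) (G (z k)) (zstar - zbar k)
  have hk : (0 : ℝ) ≤ k := k.cast_nonneg
  have hA : αinf * ((k : ℝ) + 1) * ((k : ℝ) + 2) / 2 * ‖G (z k)‖ ^ 2 ≤
      α k * ((k : ℝ) + 1) * ((k : ℝ) + 2) / 2 * ‖G (z k)‖ ^ 2 := by gcongr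
  have hA' : αinf * ((k : ℝ) + 1) ^ 2 / 4 * ‖G (z k)‖ ^ 2 ≤
      αinf * (((k : ℝ) + 1) * ((k : ℝ) + 2)) / 4 * ‖G (z k)‖ ^ 2 := by
    gcongr
    nlinarith
  have hC : cinf * ‖zstar - zbar k‖ ^ 2 ≤ c k * ‖zstar - zbar k‖ ^ 2 := by gcongr
  have hM : 0 ≤ ((k : ℝ) + 1) * ⟪G (z k), z k - zstar⟫ := by positivity
  rw [hsplit] at hV
  rw [le_div_iff₀ (by positivity)]
  linarith
end

section
/- Let E be a real inner product space, N ≥ 1, R > 0, α ≥ 0, and let G, G_1, ..., G_N : E → E with G R-Lipschitz. Fix z, u ∈ E and suppose (1/N)·∑_{i=1}^N G_i(z) = G(z). For each i set w_i := z + u − α·G_i(z). Then |(1/N)·∑_{i=1}^N ⟨G(w_i), G_i(z) − G(z)⟩| ≤ R·α·(1/N)·∑_{i=1}^N ‖G_i(z) − G(z)‖². -/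
open RealInnerProductSpace

/-- bound on the average bias cross-term: with `w_i = z + u − α G_i(z)`,
`|(1/N)∑ᵢ ⟪G(wᵢ), Gᵢ(z) − G(z)⟫| ≤ Rα · (1/N)∑ᵢ ‖Gᵢ(z) − G(z)‖²`. -/
theorem stmt_9 {E : Type*} [NormedAddCommGroup E] [InnerProductSpace ℝ E]
    (N : ℕ) (hN : 1 ≤ N) (R α : ℝ) (hR : 0 < R) (hα : 0 ≤ α)
    (G : E → E) (Gi : Fin N → E → E)
    (hlip : ∀ u v : E, ‖G u - G v‖ ≤ R * ‖u - v‖)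
    (z u : E)
    (hunb : (1 / (N : ℝ)) • ∑ i, Gi i z = G z) :
    |(1 / (N : ℝ)) * ∑ i, ⟪G (z + u - α • Gi i z), Gi i z - G z⟫|
      ≤ R * α * ((1 / (N : ℝ)) * ∑ i, ‖Gi i z - G z‖ ^ 2) := by
  have hN0 : (N : ℝ) ≠ 0 := by positivity
  have hsum : ∑ i, (Gi i z - G z) = 0 := by
    rw [Finset.sum_sub_distrib, Finset.sum_const, Finset.card_univ, Fintype.card_fin,
      ← Nat.cast_smul_eq_nsmul ℝ, ← hunb, smul_smul, mul_one_div_cancel hN0, one_smul, sub_self]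
  have hcenter : ∑ i, ⟪G (z + u - α • Gi i z), Gi i z - G z⟫
      = ∑ i, ⟪G (z + u - α • Gi i z) - G (z + u - α • G z), Gi i z - G z⟫ := by
    simp_rw [inner_sub_left (G _) (G _)]
    rw [Finset.sum_sub_distrib, ← inner_sum, hsum, inner_zero_right, sub_zero]
  have hterm (i : Fin N) :
      |⟪G (z + u - α • Gi i z) - G (z + u - α • G z), Gi i z - G z⟫|
        ≤ R * α * ‖Gi i z - G z‖ ^ 2 := by
    have hdist : ‖z + u - α • Gi i z - (z + u - α • G z)‖ = α * ‖Gi i z - G z‖ := by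
      rw [sub_sub_sub_cancel_left, ← smul_sub, norm_smul, Real.norm_of_nonneg hα, norm_sub_rev]
    calc _ ≤ ‖G (z + u - α • Gi i z) - G (z + u - α • G z)‖ * ‖Gi i z - G z‖ :=
          abs_real_inner_le_norm _ _
      _ ≤ (R * (α * ‖Gi i z - G z‖)) * ‖Gi i z - G z‖ := by
          rw [← hdist]
          gcongr
          exact hlip _ _
      _ = R * α * ‖Gi i z - G z‖ ^ 2 := by ring
  rw [hcenter, abs_mul, abs_of_nonneg (by positivity : (0 : ℝ) ≤ 1 / N), mul_left_comm,
    Finset.mul_sum]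
  gcongr
  exact (Finset.abs_sum_le_sum_abs _ _).trans (Finset.sum_le_sum fun i _ => hterm i)
end

section
/- Let E be a real inner product space, N ≥ 1, and let G, G_1, ..., G_N : E → E. Fix w, z̄, z* ∈ E and suppose (1/N)·∑_{l=1}^N G_l(w) = G(w) and (1/N)·∑_{l=1}^N ‖G_l(w)‖² ≤ C·‖G(w)‖² with 1 ≤ C ≤ N, and let K̄ ≥ N·C. Let c > 0, δ > 0, B > 0, set c⁺ := c/(1 + δ) and γ̃ := B/(c⁺·K̄·(1 + 1/δ)). Then c·‖z* − z̄‖² − c⁺·(1/N)·∑_{l=1}^N ‖z* − (z̄ + γ̃·G_l(w))‖² + B·γ̃·(1/N)·∑_{l=1}^N ⟨G_l(w), G(w)⟩ ≥ 0. -/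
open RealInnerProductSpace

/-- Young's inequality for the squared norm of a difference. -/
theorem norm_sub_sq_le_young {E : Type*} [NormedAddCommGroup E] [InnerProductSpace ℝ E]
    (x y : E) {δ : ℝ} (hδ : 0 < δ) :
    ‖x - y‖ ^ 2 ≤ (1 + δ) * ‖x‖ ^ 2 + (1 + 1 / δ) * ‖y‖ ^ 2 := by
  have hsq : 0 ≤ δ * (‖x‖ - ‖y‖ / δ) ^ 2 := by positivity
  have hexp : δ * (‖x‖ - ‖y‖ / δ) ^ 2 =
      δ * ‖x‖ ^ 2 - 2 * (‖x‖ * ‖y‖) + 1 / δ * ‖y‖ ^ 2 := by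
    field_simp
    ring
  have hcs := neg_le_of_abs_le (abs_real_inner_le_norm x y)
  rw [norm_sub_sq_real]
  linarith

/-- nonnegativity of the anchor-term contribution (term II) in the
stochastic Lyapunov descent, averaged over the `N` possible anchor updates. -/
theorem stmt_11 {E : Type*} [NormedAddCommGroup E] [InnerProductSpace ℝ E]
    (N : ℕ) (hN : 1 ≤ N) (G : E → E) (Gl : Fin N → E → E)
    (w zbar zstar : E) (C Kbar : ℝ)
    (hunb : (1 / (N : ℝ)) • ∑ l, Gl l w = G w)
    (hcond : (1 / (N : ℝ)) * ∑ l, ‖Gl l w‖ ^ 2 ≤ C * ‖G w‖ ^ 2)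
    (hC1 : 1 ≤ C) (hCN : C ≤ (N : ℝ)) (hK : (N : ℝ) * C ≤ Kbar)
    (c δ B cplus γ : ℝ) (hc : 0 < c) (hδ : 0 < δ) (hB : 0 < B)
    (hcplus : cplus = c / (1 + δ))
    (hγ : γ = B / (cplus * Kbar * (1 + 1 / δ))) :
    c * ‖zstar - zbar‖ ^ 2 -
        cplus * ((1 / (N : ℝ)) * ∑ l, ‖zstar - (zbar + γ • Gl l w)‖ ^ 2) +
        B * γ * ((1 / (N : ℝ)) * ∑ l, ⟪Gl l w, G w⟫) ≥ 0 := by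
  have hN0 : (0 : ℝ) < N := by exact_mod_cast hN
  have hN1 : (1 : ℝ) ≤ N := by exact_mod_cast hN
  have hCK : C ≤ Kbar := by nlinarith
  have hK0 : 0 < Kbar := by linarith
  have hcp : 0 < cplus := by rw [hcplus]; positivity
  have hγ0 : 0 < γ := by rw [hγ]; positivity
  have hc_eq : cplus * (1 + δ) = c := by rw [hcplus]; field_simp
  have hγ_eq : cplus * (1 + 1 / δ) * γ * Kbar = B := by
    rw [hγ]
    have : 0 < 1 + 1 / δ := by positivity
    field_simp
  have hinner : (1 / (N : ℝ)) * ∑ l, ⟪Gl l w, G w⟫ = ‖G w‖ ^ 2 := by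
    rw [← sum_inner, ← real_inner_smul_left, hunb, real_inner_self_eq_norm_sq]
  have hdist : (1 / (N : ℝ)) * ∑ l, ‖zstar - (zbar + γ • Gl l w)‖ ^ 2 ≤
      (1 + δ) * ‖zstar - zbar‖ ^ 2 + (1 + 1 / δ) * γ ^ 2 * (C * ‖G w‖ ^ 2) := by
    calc (1 / (N : ℝ)) * ∑ l, ‖zstar - (zbar + γ • Gl l w)‖ ^ 2
        ≤ (1 / (N : ℝ)) * ∑ l, ((1 + δ) * ‖zstar - zbar‖ ^ 2 +
            (1 + 1 / δ) * γ ^ 2 * ‖Gl l w‖ ^ 2) := by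
          gcongr with l
          have h := norm_sub_sq_le_young (zstar - zbar) (γ • Gl l w) hδ
          rwa [norm_smul, mul_pow, Real.norm_eq_abs, sq_abs, sub_sub, ← mul_assoc] at h
      _ = (1 + δ) * ‖zstar - zbar‖ ^ 2 +
            (1 + 1 / δ) * γ ^ 2 * ((1 / (N : ℝ)) * ∑ l, ‖Gl l w‖ ^ 2) := by
          rw [Finset.sum_add_distrib, Finset.sum_const, ← Finset.mul_sum, Finset.card_univ,
            Fintype.card_fin, nsmul_eq_mul]
          field_simp
      _ ≤ _ := by gcongr
  have hslack : 0 ≤ cplus * (1 + 1 / δ) * γ ^ 2 * ‖G w‖ ^ 2 * (Kbar - C) :=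
    mul_nonneg (by positivity) (by linarith)
  rw [hinner]
  have hmul := mul_le_mul_of_nonneg_left hdist hcp.le
  rw [← hγ_eq]
  nth_rewrite 1 [← hc_eq]
  linarith
end

section
/- Let E be a real inner product space, R > 0, and G : E → E a monotone, R-Lipschitz operator with G(z*) = 0 for some z* ∈ E. Let (z^k), (z̄^k) be sequences in E, let (α_k) be positive reals decreasing to a limit α_∞ > 0 and (c_k) positive reals decreasing to a limit c_∞ with c_∞ ≥ 1/α_∞. Set A_k := α_k(k+1)(k+2)/2, B_k := k+1, and V_k := A_k‖G(z^k)‖² + B_k⟨G(z^k), z^k − z̄^k⟩ + c_k‖z* − z̄^k‖². Suppose D ≥ 0 is such that V_k ≤ (α_0 R² + c_0)‖z^0 − z*‖² + D for all k. Then for all k ≥ 0: ‖G(z^k)‖² ≤ 4·((α_0 R² + c_0)‖z^0 − z*‖² + D) / (α_∞(k+1)(k+2)). -/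
open Filter Topology RealInnerProductSpace

/-- convergence rate of the stochastic moving-anchor EAG-V from a
uniform upper bound on the Lyapunov functional. -/
theorem stmt_15 {E : Type*} [NormedAddCommGroup E] [InnerProductSpace ℝ E]
    (R : ℝ) (hR : 0 < R) (G : E → E)
    (hmono : ∀ u v : E, 0 ≤ ⟪G u - G v, u - v⟫)
    (hlip : ∀ u v : E, ‖G u - G v‖ ≤ R * ‖u - v‖)
    (zstar : E) (hzstar : G zstar = 0)
    (z zbar : ℕ → E) (α c : ℕ → ℝ) (αinf cinf : ℝ)
    (hαpos : ∀ k, 0 < α k) (hαdec : ∀ k, α (k + 1) ≤ α k)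
    (hαlim : Tendsto α atTop (𝓝 αinf)) (hαinf : 0 < αinf)
    (hcpos : ∀ k, 0 < c k) (hcdec : ∀ k, c (k + 1) ≤ c k)
    (hclim : Tendsto c atTop (𝓝 cinf))
    (hca : 1 / αinf ≤ cinf)
    (D : ℝ) (hD : 0 ≤ D)
    (hVbound : ∀ k : ℕ,
      (α k * ((k : ℝ) + 1) * ((k : ℝ) + 2) / 2) * ‖G (z k)‖ ^ 2 +
          ((k : ℝ) + 1) * ⟪G (z k), z k - zbar k⟫ +
          c k * ‖zstar - zbar k‖ ^ 2
        ≤ (α 0 * R ^ 2 + c 0) * ‖z 0 - zstar‖ ^ 2 + D) :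
    ∀ k : ℕ, ‖G (z k)‖ ^ 2 ≤
      4 * ((α 0 * R ^ 2 + c 0) * ‖z 0 - zstar‖ ^ 2 + D) /
        (αinf * ((k : ℝ) + 1) * ((k : ℝ) + 2)) := by
  intro k
  have hα : αinf ≤ α k := (antitone_nat_of_succ_le hαdec).le_of_tendsto hαlim k
  have hc : 1 / αinf ≤ c k :=
    hca.trans ((antitone_nat_of_succ_le hcdec).le_of_tendsto hclim k)
  have hinner : -(‖G (z k)‖ * ‖zstar - zbar k‖) ≤ ⟪G (z k), z k - zbar k⟫ := by
    have hm := hmono (z k) zstar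
    rw [hzstar, sub_zero] at hm
    have hcs := (abs_le.mp (abs_real_inner_le_norm (G (z k)) (zstar - zbar k))).1
    rw [← sub_add_sub_cancel (z k) zstar (zbar k), inner_add_right]
    linarith
  have hV := hVbound k
  generalize (α 0 * R ^ 2 + c 0) * ‖z 0 - zstar‖ ^ 2 + D = M at hV ⊢
  generalize ⟪G (z k), z k - zbar k⟫ = p at hinner hV
  generalize ‖G (z k)‖ = g at hinner hV ⊢
  generalize ‖zstar - zbar k‖ = d at hinner hV
  have hn : (0 : ℝ) < (k : ℝ) + 1 := by positivity
  have hn' : (0 : ℝ) < (k : ℝ) + 2 := by positivity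
  rw [le_div_iff₀ (by positivity)]
  have hp := mul_le_mul_of_nonneg_left hinner hn.le
  have hd := mul_le_mul_of_nonneg_right hc (sq_nonneg d)
  have hg := mul_le_mul_of_nonneg_right hα
    (show 0 ≤ ((k : ℝ) + 1) * ((k : ℝ) + 2) / 2 * g ^ 2 by positivity)
  have hyoung : ((k : ℝ) + 1) * (g * d) ≤
      αinf * ((k : ℝ) + 1) ^ 2 / 4 * g ^ 2 + 1 / αinf * d ^ 2 := by
    have h : αinf * ((k : ℝ) + 1) ^ 2 / 4 * g ^ 2 + 1 / αinf * d ^ 2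
        - ((k : ℝ) + 1) * (g * d) = (αinf * ((k : ℝ) + 1) * g / 2 - d) ^ 2 / αinf := by
      field_simp
      ring
    have h' : 0 ≤ (αinf * ((k : ℝ) + 1) * g / 2 - d) ^ 2 / αinf := by positivity
    linarith
  have hrest : 0 ≤ αinf * ((k : ℝ) + 1) * g ^ 2 := by positivity
  linarith
end
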